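/- Let G be a group of isometries of ℝ^n that tiles ℝ^n with an n-dimensional convex polytope Π, let Π̃ ⊆ Π be a transversal, and let p be the associated projector. Let C_pbc(Π) be the space of continuous real-valued functions on Π satisfying the periodic boundary condition, and let C_G be the space of continuous G-invariant real-valued functions on ℝ^n. Then every element of C_G is bounded, the map I_Π : h ↦ h∘p is a linear bijection from C_pbc(Π) onto C_G satisfying sup_{x∈Π}|h(x)| = sup_{x∈ℝ^n}|h(p(x))| for every h ∈ C_pbc(Π) (an isometric isomorphism for the supremum norms), and consequently C_G equipped with the supremum norm is a separable Banach space. -/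

import Mathlib

open Set Metric MeasureTheory Filter

noncomputable section

abbrev Euc (n : ℕ) : Type := EuclideanSpace ℝ (Fin n)

/-- `P` is an `n`-dimensional convex polytope in `ℝⁿ`: the convex hull of a finite set
whose affine span is all of the space. -/
def IsConvexPolytope {n : ℕ} (P : Set (Euc n)) : Prop :=
  ∃ V : Finset (Euc n), P = convexHull ℝ (V : Set (Euc n)) ∧ affineSpan ℝ (V : Set (Euc n)) = ⊤

/-- The group of isometries `G` tiles `ℝⁿ` with the set `P`. -/
def Tiles {n : ℕ} (G : Subgroup (Euc n ≃ᵢ Euc n)) (P : Set (Euc n)) : Prop :=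
  (⋃ φ ∈ G, ⇑φ '' P) = Set.univ ∧
  ∀ φ ∈ G, ∀ ψ ∈ G, φ ≠ ψ → (⇑φ '' P ∩ ⇑ψ '' P) ⊆ frontier (⇑φ '' P)

/-- A function on `ℝⁿ` is `G`-invariant if `f ∘ φ = f` for all `φ ∈ G`. -/
def GInvariant {n : ℕ} {X : Type*} (G : Subgroup (Euc n ≃ᵢ Euc n)) (f : Euc n → X) : Prop :=
  ∀ φ ∈ G, ∀ x, f (φ x) = f x

/-- `h` satisfies the periodic boundary condition on `P`. -/
def SatisfiesPBC {n : ℕ} {X : Type*} (G : Subgroup (Euc n ≃ᵢ Euc n)) (P : Set (Euc n))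
    (h : Euc n → X) : Prop :=
  ∀ x ∈ P, ∀ φ ∈ G, φ ≠ 1 → φ x ∈ P → h (φ x) = h x

/-- `T` is a transversal for `G`: it contains exactly one point of each orbit. -/
def IsTransversal {n : ℕ} (G : Subgroup (Euc n ≃ᵢ Euc n)) (T : Set (Euc n)) : Prop :=
  ∀ x : Euc n, ∃! y, y ∈ T ∧ ∃ φ ∈ G, y = φ x

section

variable {n : ℕ} {G : Subgroup (Euc n ≃ᵢ Euc n)} {P T : Set (Euc n)}

theorem IsConvexPolytope.isCompact (hP : IsConvexPolytope P) : IsCompact P := by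
  obtain ⟨V, rfl, -⟩ := hP
  exact V.finite_toSet.isCompact_convexHull ℝ

theorem IsConvexPolytope.interior_nonempty (hP : IsConvexPolytope P) :
    (interior P).Nonempty := by
  obtain ⟨V, rfl, hV⟩ := hP
  exact interior_convexHull_nonempty_iff_affineSpan_eq_top.2 hV

/-- Images of an interior point under distinct elements of a tiling group are uniformly
separated. -/
theorem Tiles.le_dist_of_ball_subset (hT : Tiles G P) {c : Euc n} {r : ℝ} (hr : 0 < r)
    (hc : ball c r ⊆ P) {φ ψ : Euc n ≃ᵢ Euc n} (hφ : φ ∈ G) (hψ : ψ ∈ G) (hne : φ ≠ ψ) :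
    r ≤ dist (ψ c) (φ c) := by
  by_contra! h
  have hcP : c ∈ P := hc (mem_ball_self hr)
  have hsub : ball (φ c) r ⊆ φ '' P := by
    rw [← φ.image_ball]
    exact image_mono hc
  have hint : ψ c ∈ interior (φ '' P) := interior_maximal hsub isOpen_ball h
  exact (hT.2 φ hφ ψ hψ hne ⟨interior_subset hint, mem_image_of_mem _ hcP⟩).2 hint

/-- A tiling by a convex polytope is locally finite. -/
theorem Tiles.locallyFinite (hT : Tiles G P) (hP : IsConvexPolytope P) :
    LocallyFinite fun φ : G => (φ : Euc n ≃ᵢ Euc n) '' P := by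
  obtain ⟨c, hc⟩ := hP.interior_nonempty
  obtain ⟨r, hr, hcr⟩ := Metric.isOpen_iff.1 isOpen_interior c hc
  replace hcr := hcr.trans interior_subset
  obtain ⟨D, hD⟩ := hP.isCompact.isBounded.subset_closedBall c
  intro x
  refine ⟨ball x 1, ball_mem_nhds x one_pos, ?_⟩
  obtain ⟨t, ht, hcov⟩ := Metric.totallyBounded_iff.1
    (isCompact_closedBall x (D + 1)).totallyBounded (r / 2) (half_pos hr)
  have hcenter : ∀ φ : G, ((φ : Euc n ≃ᵢ Euc n) '' P ∩ ball x 1).Nonempty →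
      ∃ y ∈ t, dist ((φ : Euc n ≃ᵢ Euc n) c) y < r / 2 := by
    rintro φ ⟨-, ⟨z, hz, rfl⟩, hzx⟩
    have hmem : (φ : Euc n ≃ᵢ Euc n) c ∈ closedBall x (D + 1) := by
      have h1 := dist_triangle_left ((φ : Euc n ≃ᵢ Euc n) c) x ((φ : Euc n ≃ᵢ Euc n) z)
      have h2 := mem_closedBall.1 (hD hz)
      rw [IsometryEquiv.dist_eq] at h1
      exact mem_closedBall.2 (by linarith [mem_ball.1 hzx])
    simpa using hcov hmem
  choose! y hyt hy using hcenter
  refine Set.Finite.of_injOn (f := y) (fun φ hφ => hyt φ hφ) ?_ ht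
  intro φ hφ ψ hψ heq
  by_contra hne
  have h1 := hT.le_dist_of_ball_subset hr hcr φ.2 ψ.2 (fun h => hne (Subtype.ext h))
  have h2 := hy φ hφ
  have h3 := hy ψ hψ
  rw [← heq] at h3
  linarith [dist_triangle_right ((ψ : Euc n ≃ᵢ Euc n) c) ((φ : Euc n ≃ᵢ Euc n) c) (y φ)]

theorem SatisfiesPBC.apply_eq {X : Type*} {h : Euc n → X} (hh : SatisfiesPBC G P h)
    {φ : Euc n ≃ᵢ Euc n} (hφ : φ ∈ G) {x : Euc n} (hx : x ∈ P) (hφx : φ x ∈ P) :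
    h (φ x) = h x := by
  by_cases h1 : φ = 1
  · rw [h1, IsometryEquiv.coe_one, id]
  · exact hh x hx φ hφ h1 hφx

theorem GInvariant.satisfiesPBC {X : Type*} {f : Euc n → X} (hf : GInvariant G f) :
    SatisfiesPBC G P f :=
  fun x _ φ hφ _ _ => hf φ hφ x

theorem SatisfiesPBC.apply_projector {X : Type*} {h : Euc n → X} (hh : SatisfiesPBC G P h)
    (hTP : T ⊆ P) {p : Euc n → Euc n} (hp : ∀ x, p x ∈ T ∧ ∃ φ ∈ G, p x = φ x)
    {φ : Euc n ≃ᵢ Euc n} (hφ : φ ∈ G) {x : Euc n} (hx : x ∈ P) : h (p (φ x)) = h x := by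
  obtain ⟨hpT, ψ, hψ, hpψ⟩ := hp (φ x)
  have hmul : p (φ x) = (ψ * φ) x := by rw [hpψ, IsometryEquiv.mul_apply]
  rw [hmul]
  exact hh.apply_eq (G.mul_mem hψ hφ) hx (hmul ▸ hTP hpT)

theorem GInvariant.comp_projector {X : Type*} {f : Euc n → X} (hf : GInvariant G f)
    {p : Euc n → Euc n} (hp : ∀ x, p x ∈ T ∧ ∃ φ ∈ G, p x = φ x) : f ∘ p = f := by
  funext x
  obtain ⟨-, φ, hφ, h⟩ := hp x
  rw [Function.comp_apply, h, hf φ hφ]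

theorem IsTransversal.projector_apply (htrans : IsTransversal G T) {p : Euc n → Euc n}
    (hp : ∀ x, p x ∈ T ∧ ∃ φ ∈ G, p x = φ x) {φ : Euc n ≃ᵢ Euc n} (hφ : φ ∈ G) (x : Euc n) :
    p (φ x) = p x := by
  obtain ⟨hpT, ψ, hψ, hpψ⟩ := hp (φ x)
  exact (htrans x).unique
    ⟨hpT, ψ * φ, G.mul_mem hψ hφ, by rw [hpψ, IsometryEquiv.mul_apply]⟩ (hp x)

theorem Tiles.exists_apply_eq (hT : Tiles G P) (x : Euc n) : ∃ φ ∈ G, ∃ y ∈ P, φ y = x := by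
  have hx : x ∈ ⋃ φ ∈ G, ⇑φ '' P := hT.1 ▸ mem_univ x
  simpa using hx

theorem SatisfiesPBC.continuous_comp_projector {X : Type*} [TopologicalSpace X] {h : Euc n → X}
    (hh : SatisfiesPBC G P h) (hcont : ContinuousOn h P) (hP : IsConvexPolytope P)
    (hT : Tiles G P) (hTP : T ⊆ P) {p : Euc n → Euc n}
    (hp : ∀ x, p x ∈ T ∧ ∃ φ ∈ G, p x = φ x) : Continuous (h ∘ p) := by
  refine (hT.locallyFinite hP).continuous ?_ (fun φ => ?_) fun φ => ?_
  · refine eq_univ_of_forall fun x => ?_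
    obtain ⟨φ, hφ, y, hy, rfl⟩ := hT.exists_apply_eq x
    exact mem_iUnion.2 ⟨⟨φ, hφ⟩, mem_image_of_mem _ hy⟩
  · exact (hP.isCompact.image (φ : Euc n ≃ᵢ Euc n).continuous).isClosed
  · have hc : ContinuousOn (h ∘ (φ : Euc n ≃ᵢ Euc n).symm) ((φ : Euc n ≃ᵢ Euc n) '' P) := by
      refine hcont.comp (φ : Euc n ≃ᵢ Euc n).symm.continuous.continuousOn ?_
      rintro - ⟨y, hy, rfl⟩
      rwa [IsometryEquiv.symm_apply_apply]
    refine hc.congr ?_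
    rintro - ⟨y, hy, rfl⟩
    simp only [Function.comp_apply, IsometryEquiv.symm_apply_apply]
    exact hh.apply_projector hTP hp φ.2 hy

/-- A property of the values of an invariant function holds everywhere if it holds on a tile. -/
theorem GInvariant.forall_of_forall_mem {X : Type*} {f : Euc n → X} (hf : GInvariant G f)
    (hT : Tiles G P) {q : X → Prop} (hq : ∀ x ∈ P, q (f x)) (x : Euc n) : q (f x) := by
  obtain ⟨φ, hφ, y, hy, rfl⟩ := hT.exists_apply_eq x
  rw [hf φ hφ]
  exact hq y hy

theorem isClosed_setOf_gInvariant (G : Subgroup (Euc n ≃ᵢ Euc n)) :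
    IsClosed {f : BoundedContinuousFunction (Euc n) ℝ | GInvariant G ⇑f} := by
  simp only [GInvariant, ofPred_forall]
  exact isClosed_iInter fun φ => isClosed_iInter fun _ => isClosed_iInter fun x =>
    isClosed_eq (continuous_eval_const (φ x))
      (continuous_eval_const x)

theorem Tiles.isSeparable_setOf_gInvariant (hT : Tiles G P) (hP : IsConvexPolytope P) :
    TopologicalSpace.IsSeparable
      {f : BoundedContinuousFunction (Euc n) ℝ | GInvariant G ⇑f} := by
  have : CompactSpace P := isCompact_iff_compactSpace.1 hP.isCompact
  let R : {f : BoundedContinuousFunction (Euc n) ℝ | GInvariant G ⇑f} → C(P, ℝ) :=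
    fun f => f.1.toContinuousMap.restrict P
  have hR : Isometry R := by
    refine Isometry.of_dist_eq fun f g => le_antisymm ?_ ?_
    · exact (ContinuousMap.dist_le dist_nonneg).2 fun x =>
        BoundedContinuousFunction.dist_coe_le_dist (x : Euc n)
    · refine (BoundedContinuousFunction.dist_le dist_nonneg).2 fun x => ?_
      obtain ⟨φ, hφ, y, hy, rfl⟩ := hT.exists_apply_eq x
      rw [f.2 φ hφ, g.2 φ hφ]
      exact ContinuousMap.dist_apply_le_dist (f := R f) (g := R g) ⟨y, hy⟩
  have := hR.isEmbedding.secondCountableTopology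
  exact TopologicalSpace.IsSeparable.of_subtype _

end

/-- The map `I_Π : h ↦ h ∘ p` is an isometric isomorphism (for the supremum norms) from the
space of continuous functions on `Π` satisfying the periodic boundary condition onto the
space `C_G` of continuous `G`-invariant functions; every element of `C_G` is bounded, and
`C_G` (as a subspace of the bounded continuous functions, closed under the vector-space
operations) is a closed and separable subspace, hence a separable Banach space. -/
theorem CG_separable_banach (n : ℕ) (G : Subgroup (Euc n ≃ᵢ Euc n)) (P T : Set (Euc n))
    (hP : IsConvexPolytope P) (hT : Tiles G P) (hTP : T ⊆ P) (htrans : IsTransversal G T)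
    (p : Euc n → Euc n) (hp : ∀ x : Euc n, p x ∈ T ∧ ∃ φ ∈ G, p x = φ x) :
    -- every continuous G-invariant function is bounded
    (∀ f : Euc n → ℝ, Continuous f → GInvariant G f → ∃ C : ℝ, ∀ x, |f x| ≤ C) ∧
    -- I_Π maps C_pbc(Π) into C_G and preserves the supremum norm
    (∀ h : Euc n → ℝ, ContinuousOn h P → SatisfiesPBC G P h →
      Continuous (h ∘ p) ∧ GInvariant G (h ∘ p) ∧
        sSup {y : ℝ | ∃ x ∈ P, y = |h x|} = sSup {y : ℝ | ∃ x : Euc n, y = |h (p x)|}) ∧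
    -- I_Π is linear
    (∀ h h' : Euc n → ℝ, ∀ a b : ℝ,
      (fun x => a * h x + b * h' x) ∘ p = fun x => a * (h ∘ p) x + b * (h' ∘ p) x) ∧
    -- I_Π is injective (on functions on Π) and surjective onto C_G
    (∀ h h' : Euc n → ℝ, ContinuousOn h P → SatisfiesPBC G P h →
      ContinuousOn h' P → SatisfiesPBC G P h' → h ∘ p = h' ∘ p → Set.EqOn h h' P) ∧
    (∀ f : Euc n → ℝ, Continuous f → GInvariant G f →
      ∃ h : Euc n → ℝ, ContinuousOn h P ∧ SatisfiesPBC G P h ∧ f = h ∘ p) ∧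
    -- C_G, viewed inside the bounded continuous functions with the sup norm, is a
    -- linear subspace that is closed and separable: a separable Banach space
    (∀ f g : BoundedContinuousFunction (Euc n) ℝ, ∀ a : ℝ,
      GInvariant G ⇑f → GInvariant G ⇑g → GInvariant G ⇑(f + g) ∧ GInvariant G ⇑(a • f)) ∧
    IsClosed {f : BoundedContinuousFunction (Euc n) ℝ | GInvariant G ⇑f} ∧
    TopologicalSpace.IsSeparable {f : BoundedContinuousFunction (Euc n) ℝ | GInvariant G ⇑f} := by
  refine ⟨fun f hf hG => ?_, fun h hc hpbc => ⟨?_, ?_, ?_⟩, fun _ _ _ _ => rfl,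
    fun h h' _ hpbc _ hpbc' heq x hx => ?_, fun f hf hG => ?_, fun f g a hf hg => ⟨?_, ?_⟩,
    isClosed_setOf_gInvariant G, hT.isSeparable_setOf_gInvariant hP⟩
  · obtain ⟨C, hC⟩ := hP.isCompact.exists_bound_of_continuousOn hf.continuousOn
    exact ⟨C, hG.forall_of_forall_mem (q := fun y => |y| ≤ C) hT hC⟩
  · exact hpbc.continuous_comp_projector hc hP hT hTP hp
  · exact fun φ hφ x => congrArg h (htrans.projector_apply hp hφ x)
  · congr 1
    ext y
    constructor
    · rintro ⟨x, hx, rfl⟩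
      exact ⟨x, by rw [← hpbc.apply_projector hTP hp G.one_mem hx, IsometryEquiv.coe_one, id]⟩
    · rintro ⟨x, rfl⟩
      exact ⟨p x, hTP (hp x).1, rfl⟩
  · rw [← hpbc.apply_projector hTP hp G.one_mem hx, ← hpbc'.apply_projector hTP hp G.one_mem hx]
    exact congrFun heq _
  · exact ⟨f, hf.continuousOn, hG.satisfiesPBC, (hG.comp_projector hp).symm⟩
  · intro φ hφ x
    simp only [BoundedContinuousFunction.coe_add, Pi.add_apply, hf φ hφ, hg φ hφ]
  · intro φ hφ x
    simp only [BoundedContinuousFunction.coe_smul, hf φ hφ]
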